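/- Let n ≥ 2 and 1 ≤ k ≤ n−1. Let U_1,…,U_n be i.i.d. Uniform(0,1) random variables with order statistics U_{[1]} ≤ … ≤ U_{[n]}, and let D be a Beta(1/2,1/2) random variable independent of (U_1,…,U_n). Then the fiducial quantity θ̂ = U_{[k]} + D·(U_{[k+1]} − U_{[k]}) has the Beta(k + 1/2, n − k + 1/2) distribution, i.e., its law has Lebesgue density x ↦ x^{k−1/2}(1−x)^{n−k−1/2}/B(k+1/2, n−k+1/2) on (0,1). This is the Jeffreys-prior posterior distribution for a binomial proportion with k observed successes in n trials, and it is the distribution of the FIMA solution when the interpolation variable D is chosen Beta(1/2,1/2). -/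

import Mathlib

open MeasureTheory ProbabilityTheory Finset

/-- The `k`-th smallest value among `f 0, …, f (n-1)` (for `1 ≤ k ≤ n`). -/
noncomputable def orderStat (n : ℕ) (f : Fin n → ℝ) (k : ℕ) : ℝ :=
  sInf {x : ℝ | k ≤ (Finset.univ.filter fun i => f i ≤ x).card}

/-- Density (with respect to Lebesgue measure) of the Beta(`a`,`b`) distribution:
`x ↦ x^(a-1)(1-x)^(b-1)/B(a,b)` on `(0,1)`, where `B(a,b) = Γ(a)Γ(b)/Γ(a+b)`. -/
noncomputable def betaDensity (a b : ℝ) : ℝ → ENNReal := fun x =>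
  ENNReal.ofReal (Set.indicator (Set.Ioo (0 : ℝ) 1)
    (fun x => x ^ (a - 1) * (1 - x) ^ (b - 1)
      / (Real.Gamma a * Real.Gamma b / Real.Gamma (a + b))) x)

lemma orderStat_le_iff {n k : ℕ} (hk : 1 ≤ k) (hkn : k ≤ n) (f : Fin n → ℝ) (a : ℝ) :
    orderStat n f k ≤ a ↔ k ≤ (Finset.univ.filter fun i => f i ≤ a).card := by
  have hmono : ∀ {b c : ℝ}, b ≤ c →
      (Finset.univ.filter fun i => f i ≤ b).card ≤ (Finset.univ.filter fun i => f i ≤ c).card :=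
    fun hbc => Finset.card_le_card fun i hi => by
      simp only [Finset.mem_filter, Finset.mem_univ, true_and] at hi ⊢
      exact hi.trans hbc
  have hbdd : BddBelow {x : ℝ | k ≤ (Finset.univ.filter fun i => f i ≤ x).card} := by
    obtain ⟨m, hm⟩ := (Set.finite_range f).bddBelow
    refine ⟨m, fun x hx => ?_⟩
    obtain ⟨i, hi⟩ := Finset.card_pos.mp (lt_of_lt_of_le hk hx)
    exact (hm ⟨i, rfl⟩).trans (Finset.mem_filter.mp hi).2
  have hne : {x : ℝ | k ≤ (Finset.univ.filter fun i => f i ≤ x).card}.Nonempty := by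
    obtain ⟨M, hM⟩ := (Set.finite_range f).bddAbove
    refine ⟨M, ?_⟩
    have : (Finset.univ.filter fun i => f i ≤ M) = Finset.univ :=
      Finset.filter_true_of_mem fun i _ => hM ⟨i, rfl⟩
    simpa [this] using hkn
  refine ⟨fun h => ?_, fun h => csInf_le hbdd h⟩
  have hev : ∀ᶠ b in nhdsWithin a (Set.Ioi a), ∀ i, f i ≤ b → f i ≤ a := by
    refine Filter.eventually_all.mpr fun i => ?_
    rcases le_or_gt (f i) a with hi | hi
    · exact Filter.Eventually.of_forall fun _ _ => hi
    · filter_upwards [Ioo_mem_nhdsGT hi] with b hb hib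
      exact absurd hib hb.2.not_ge
  obtain ⟨b, hb, hab⟩ := (hev.and self_mem_nhdsWithin).exists
  obtain ⟨c, hc, hcb⟩ := exists_lt_of_csInf_lt hne (lt_of_le_of_lt h hab)
  exact (le_trans hc (hmono hcb.le)).trans <| Finset.card_le_card fun i hi => by
    simp only [Finset.mem_filter, Finset.mem_univ, true_and] at hi ⊢
    exact hb i hi

lemma measurable_orderStat {n k : ℕ} (hk : 1 ≤ k) (hkn : k ≤ n) :
    Measurable fun f : Fin n → ℝ => orderStat n f k := by
  refine measurable_of_Iic fun a => ?_
  have hset : (fun f : Fin n → ℝ => orderStat n f k) ⁻¹' Set.Iic a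
      = {f | k ≤ ∑ i, if f i ≤ a then 1 else 0} := by
    ext f
    simp [orderStat_le_iff hk hkn]
  rw [hset]
  refine measurableSet_le measurable_const (Finset.measurable_sum _ fun i _ => ?_)
  exact Measurable.ite (measurableSet_le (measurable_pi_apply i) measurable_const)
    measurable_const measurable_const

lemma orderStat_le_and_lt_orderStat_succ_iff {n k : ℕ} (hk : 1 ≤ k) (hkn : k + 1 ≤ n)
    (f : Fin n → ℝ) {a b : ℝ} (hab : a ≤ b) :
    (orderStat n f k ≤ a ∧ b < orderStat n f (k + 1)) ↔
      ∃ S ∈ Finset.powersetCard k (Finset.univ : Finset (Fin n)),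
        ∀ i, f i ∈ if i ∈ S then Set.Iic a else Set.Ioi b := by
  rw [orderStat_le_iff hk (by omega), ← not_le, orderStat_le_iff (by omega) hkn, not_le]
  constructor
  · rintro ⟨h1, h2⟩
    have hsub : (Finset.univ.filter fun i => f i ≤ a) ⊆ Finset.univ.filter fun i => f i ≤ b :=
      fun i hi => by
        simp only [Finset.mem_filter, Finset.mem_univ, true_and] at hi ⊢
        exact hi.trans hab
    have heq := Finset.eq_of_subset_of_card_le hsub (by omega)
    refine ⟨Finset.univ.filter fun i => f i ≤ a, ?_, fun i => ?_⟩
    · have := Finset.card_le_card hsub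
      simp only [Finset.mem_powersetCard, Finset.subset_univ, true_and]
      omega
    · split_ifs with hi
      · simpa using hi
      · rw [heq] at hi
        simpa using hi
  · rintro ⟨S, hS, h⟩
    have hcard := (Finset.mem_powersetCard.mp hS).2
    have ha : S ⊆ Finset.univ.filter fun i => f i ≤ a := fun i hi => by
      have := h i
      simp only [hi, if_true, Set.mem_Iic] at this
      simpa using this
    have hb : (Finset.univ.filter fun i => f i ≤ b) ⊆ S := fun i hi => by
      by_contra hiS
      have := h i
      simp only [hiS, if_false, Set.mem_Ioi] at this
      exact absurd (Finset.mem_filter.mp hi).2 this.not_ge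
    have h1 := Finset.card_le_card ha
    have h2 := Finset.card_le_card hb
    omega

/-- Exactly `k` of the `n` observations lie below `a` and the remaining ones lie above `b`. -/
lemma measure_orderStat_le_and_lt_orderStat_succ
    {Ω : Type*} [MeasurableSpace Ω] {μ : Measure Ω} {n k : ℕ} (hk : 1 ≤ k) (hkn : k + 1 ≤ n)
    {U : Fin n → Ω → ℝ} (hU : ∀ i, Measurable (U i)) {ρ : Measure ℝ}
    (hlaw : ∀ i, Measure.map (U i) μ = ρ) (hindep : iIndepFun U μ) {a b : ℝ} (hab : a ≤ b) :
    μ {ω | orderStat n (fun i => U i ω) k ≤ a ∧ b < orderStat n (fun i => U i ω) (k + 1)}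
      = n.choose k * (ρ (Set.Iic a) ^ k * ρ (Set.Ioi b) ^ (n - k)) := by
  let s : Finset (Fin n) → Fin n → Set ℝ := fun S i => if i ∈ S then Set.Iic a else Set.Ioi b
  have hs : ∀ S i, MeasurableSet (s S i) := fun S i => by
    by_cases h : i ∈ S <;> simp [s, h]
  have hset : {ω | orderStat n (fun i => U i ω) k ≤ a ∧ b < orderStat n (fun i => U i ω) (k + 1)}
      = ⋃ S ∈ Finset.powersetCard k (Finset.univ : Finset (Fin n)),
          ⋂ i ∈ Finset.univ, U i ⁻¹' s S i := by
    ext ω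
    simp only [Set.mem_ofPred_eq, orderStat_le_and_lt_orderStat_succ_iff hk hkn _ hab,
      Set.mem_iUnion, Set.mem_iInter, Set.mem_preimage, exists_prop, Finset.mem_univ, true_imp_iff,
      s]
  rw [hset, measure_biUnion_finset]
  · have hterm : ∀ S ∈ Finset.powersetCard k (Finset.univ : Finset (Fin n)),
        μ (⋂ i ∈ Finset.univ, U i ⁻¹' s S i)
          = ρ (Set.Iic a) ^ k * ρ (Set.Ioi b) ^ (n - k) := fun S hS => by
      have hcard := (Finset.mem_powersetCard.mp hS).2
      rw [hindep.measure_inter_preimage_eq_mul _ fun i _ => hs S i]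
      have : ∀ i, μ (U i ⁻¹' s S i) = if i ∈ S then ρ (Set.Iic a) else ρ (Set.Ioi b) := fun i => by
        rw [← Measure.map_apply (hU i) (hs S i), hlaw]
        by_cases h : i ∈ S <;> simp [s, h]
      simp only [this, Finset.prod_ite, Finset.prod_const]
      congr 2
      · simpa using hcard
      · rw [Finset.filter_not, Finset.card_sdiff_of_subset (Finset.filter_subset _ _)]
        simp [hcard]
    rw [Finset.sum_congr rfl hterm]
    simp
  · intro S hS T hT hST
    refine Set.disjoint_left.mpr fun ω h1 h2 => hST ?_
    simp only [Set.mem_iInter, Set.mem_preimage, Finset.mem_univ, true_imp_iff] at h1 h2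
    ext i
    have h1 := h1 i
    have h2 := h2 i
    by_cases hiS : i ∈ S <;> by_cases hiT : i ∈ T <;> simp [s, hiS, hiT] at h1 h2 ⊢ <;> linarith
  · exact fun S _ => Finset.measurableSet_biInter _ fun i _ => hU i (hs S i)

lemma lintegral_comp_add_mul (F : ℝ → ENNReal) (l : ℝ) {w : ℝ} (hw : 0 < w) :
    ∫⁻ t, F t = ∫⁻ d, ENNReal.ofReal w * F (l + d * w) := by
  have hsurj : Function.Surjective fun d : ℝ => l + d * w := fun t =>
    ⟨(t - l) / w, by field_simp; ring⟩
  have h := lintegral_image_eq_lintegral_abs_deriv_mul (s := Set.univ) (f := fun d => l + d * w)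
    (f' := fun _ => w) MeasurableSet.univ
    (fun x _ => by
      simpa using (((hasDerivAt_id' x).mul_const w).const_add l).hasDerivWithinAt (s := Set.univ))
    (fun x _ y _ hxy => by simpa [hw.ne'] using hxy) F
  rw [Set.image_univ, hsurj.range_eq] at h
  simpa [abs_of_pos hw] using h

/-- The unnormalised Beta density transported to the interval `(l, r)`. -/
noncomputable def betaKernel (a b l r x : ℝ) : ENNReal :=
  ENNReal.ofReal (Set.indicator (Set.Ioo l r) (fun x => (x - l) ^ (a - 1) * (r - x) ^ (b - 1)) x)

@[fun_prop]
lemma measurable_betaKernel (a b l r : ℝ) : Measurable (betaKernel a b l r) :=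
  ENNReal.measurable_ofReal.comp (Measurable.indicator (by fun_prop) measurableSet_Ioo)

lemma betaDensity_eq_betaKernel {a b : ℝ} (ha : 0 < a) (hb : 0 < b) (x : ℝ) :
    betaDensity a b x = ENNReal.ofReal (beta a b)⁻¹ * betaKernel a b 0 1 x := by
  rw [betaDensity, betaKernel, ← ENNReal.ofReal_mul (inv_pos.mpr (beta_pos ha hb)).le]
  congr 1
  by_cases hx : x ∈ Set.Ioo (0 : ℝ) 1
  · simp only [Set.indicator_of_mem hx, beta, sub_zero]
    rw [div_eq_inv_mul]
  · simp [Set.indicator_of_notMem hx]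

lemma betaDensity_eq_betaPDF (a b : ℝ) : betaDensity a b = betaPDF a b := by
  funext x
  rw [betaDensity, betaPDF_eq]
  congr 1
  simp only [Set.indicator, Set.mem_Ioo]
  split_ifs
  · rw [beta]; ring
  · rfl

lemma lintegral_betaDensity {a b : ℝ} (ha : 0 < a) (hb : 0 < b) : ∫⁻ x, betaDensity a b x = 1 := by
  rw [betaDensity_eq_betaPDF, lintegral_betaPDF_eq_one ha hb]

lemma betaKernel_add_mul (a b l d : ℝ) {w : ℝ} (hw : 0 < w) :
    ENNReal.ofReal w * betaKernel a b l (l + w) (l + d * w)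
      = ENNReal.ofReal (w ^ (a + b - 1)) * betaKernel a b 0 1 d := by
  rw [betaKernel, betaKernel, ← ENNReal.ofReal_mul hw.le, ← ENNReal.ofReal_mul (by positivity)]
  congr 1
  by_cases hd : d ∈ Set.Ioo (0 : ℝ) 1
  · have hd' : l + d * w ∈ Set.Ioo l (l + w) :=
      ⟨by nlinarith [hd.1], by nlinarith [hd.2]⟩
    rw [Set.indicator_of_mem hd, Set.indicator_of_mem hd']
    have h1 : 0 ≤ 1 - d := by linarith [hd.2]
    rw [show l + d * w - l = d * w by ring, show l + w - (l + d * w) = (1 - d) * w by ring,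
      Real.mul_rpow hd.1.le hw.le, Real.mul_rpow h1 hw.le, sub_zero,
      show a + b - 1 = 1 + (a - 1) + (b - 1) by ring, Real.rpow_add hw, Real.rpow_add hw,
      Real.rpow_one]
    ring
  · have hd' : l + d * w ∉ Set.Ioo l (l + w) := fun h => hd
      ⟨by by_contra h0; nlinarith [h.1], by by_contra h0; nlinarith [h.2]⟩
    rw [Set.indicator_of_notMem hd, Set.indicator_of_notMem hd']
    simp

lemma lintegral_betaKernel {a b l r : ℝ} (ha : 0 < a) (hb : 0 < b) (hlr : l < r) :
    ∫⁻ x, betaKernel a b l r x = ENNReal.ofReal (beta a b * (r - l) ^ (a + b - 1)) := by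
  have hunit : ∫⁻ x, betaKernel a b 0 1 x = ENNReal.ofReal (beta a b) := by
    have h := lintegral_betaDensity ha hb
    simp only [betaDensity_eq_betaKernel ha hb] at h
    rw [lintegral_const_mul _ (by fun_prop), ENNReal.ofReal_inv_of_pos (beta_pos ha hb)] at h
    rw [← one_mul (∫⁻ x, betaKernel a b 0 1 x), ← ENNReal.mul_inv_cancel
      (ENNReal.ofReal_pos.mpr (beta_pos ha hb)).ne' ENNReal.ofReal_ne_top, mul_assoc, h, mul_one]
  have hw : 0 < r - l := sub_pos.mpr hlr
  rw [lintegral_comp_add_mul _ l hw]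
  have := fun d => betaKernel_add_mul a b l d hw
  rw [add_sub_cancel] at this
  simp only [this]
  rw [lintegral_const_mul _ (by fun_prop), hunit, ← ENNReal.ofReal_mul (by positivity), mul_comm]

/-- The law of an affine image of a `Beta(1/2, 1/2)` variable. -/
lemma withDensity_betaDensity_half_preimage {x y : ℝ} (hxy : x < y) {A : Set ℝ}
    (hA : MeasurableSet A) :
    volume.withDensity (betaDensity (1/2) (1/2)) {d | x + d * (y - x) ∈ A}
      = ∫⁻ t in A, ENNReal.ofReal (beta (1/2) (1/2))⁻¹ * betaKernel (1/2) (1/2) x y t := by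
  have hw : 0 < y - x := sub_pos.mpr hxy
  have hm : MeasurableSet {d : ℝ | x + d * (y - x) ∈ A} :=
    (show Measurable fun d : ℝ => x + d * (y - x) by fun_prop) hA
  rw [withDensity_apply _ hm, ← lintegral_indicator hA, ← lintegral_indicator hm,
    lintegral_comp_add_mul (A.indicator _) x hw]
  refine lintegral_congr fun d => ?_
  have hk := betaKernel_add_mul (1/2) (1/2) x d hw
  rw [add_sub_cancel, show (1/2 + 1/2 - 1 : ℝ) = 0 by norm_num, Real.rpow_zero,
    ENNReal.ofReal_one, one_mul] at hk
  by_cases hd : x + d * (y - x) ∈ A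
  · rw [Set.indicator_of_mem hd, Set.indicator_of_mem (by exact hd),
      betaDensity_eq_betaKernel (by norm_num) (by norm_num), ← hk]
    ring
  · rw [Set.indicator_of_notMem hd, Set.indicator_of_notMem (by exact hd), mul_zero]

lemma setLIntegral_Iic_betaKernel_one {a : ℝ} (ha : 0 < a) (t c : ℝ) :
    ∫⁻ x in Set.Iic c, betaKernel a 1 0 t x
      = ENNReal.ofReal (beta a 1) * ENNReal.ofReal (min c t) ^ a := by
  have hae : (Set.Iic c).indicator (betaKernel a 1 0 t) =ᵐ[volume]
      betaKernel a 1 0 (min c t) := by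
    filter_upwards [Measure.ae_ne volume c] with x hx
    by_cases hxc : x ≤ c
    · have hxc' : x < c := lt_of_le_of_ne hxc hx
      rw [Set.indicator_of_mem (by exact hxc)]
      simp [betaKernel, Set.indicator, hxc']
    · rw [Set.indicator_of_notMem (by exact hxc)]
      have hxc' : ¬x < c := fun h => hxc h.le
      simp [betaKernel, Set.indicator, hxc']
  rw [← lintegral_indicator measurableSet_Iic, lintegral_congr_ae hae]
  rcases le_or_gt (min c t) 0 with h | h
  · simp [betaKernel, Set.Ioo_eq_empty h.not_gt, ENNReal.ofReal_of_nonpos h, ha]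
  · rw [lintegral_betaKernel ha one_pos h, ENNReal.ofReal_mul (beta_pos ha one_pos).le,
      sub_zero, add_sub_cancel_right, ENNReal.ofReal_rpow_of_pos h]

lemma setLIntegral_Ioi_betaKernel_one {b : ℝ} (hb : 0 < b) (t c : ℝ) :
    ∫⁻ x in Set.Ioi c, betaKernel 1 b t 1 x
      = ENNReal.ofReal (beta 1 b) * ENNReal.ofReal (1 - max c t) ^ b := by
  have heq : (Set.Ioi c).indicator (betaKernel 1 b t 1) = betaKernel 1 b (max c t) 1 := by
    funext x
    by_cases hxc : c < x <;> simp [betaKernel, Set.indicator, hxc]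
  rw [← lintegral_indicator measurableSet_Ioi, heq]
  rcases le_or_gt 1 (max c t) with h | h
  · simp [betaKernel, Set.Ioo_eq_empty h.not_gt, ENNReal.ofReal_of_nonpos (sub_nonpos.mpr h), hb]
  · rw [lintegral_betaKernel one_pos hb h, ENNReal.ofReal_mul (beta_pos one_pos hb).le,
      add_sub_cancel_left, ENNReal.ofReal_rpow_of_pos (sub_pos.mpr h)]

lemma volume_restrict_Icc_Iic {a : ℝ} (ha : a ≤ 1) :
    volume.restrict (Set.Icc (0 : ℝ) 1) (Set.Iic a) = ENNReal.ofReal a := by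
  rw [Measure.restrict_apply measurableSet_Iic,
    show Set.Iic a ∩ Set.Icc 0 1 = Set.Icc 0 a by ext x; simp; constructor <;> intro h <;> grind,
    Real.volume_Icc, sub_zero]

lemma volume_restrict_Icc_Ioi {b : ℝ} (hb : 0 ≤ b) :
    volume.restrict (Set.Icc (0 : ℝ) 1) (Set.Ioi b) = ENNReal.ofReal (1 - b) := by
  rw [Measure.restrict_apply measurableSet_Ioi,
    show Set.Ioi b ∩ Set.Icc 0 1 = Set.Ioc b 1 by ext x; simp; grind,
    Real.volume_Ioc]

/-- The part of the joint law of two consecutive uniform order statistics that straddles `t`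
is a product measure. -/
lemma map_orderStat_restrict
    {Ω : Type*} [MeasurableSpace Ω] {μ : Measure Ω} {k m : ℕ} (hk : 1 ≤ k) (hm : 1 ≤ m)
    {U : Fin (k + m) → Ω → ℝ} (hU : ∀ i, Measurable (U i))
    (hlaw : ∀ i, Measure.map (U i) μ = volume.restrict (Set.Icc (0 : ℝ) 1))
    (hindep : iIndepFun U μ) {t : ℝ} (ht0 : 0 < t) (ht1 : t < 1) :
    (μ.map fun ω => (orderStat (k + m) (fun i => U i ω) k,
        orderStat (k + m) (fun i => U i ω) (k + 1))).restrict (Set.Iic t ×ˢ Set.Ioi t)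
      = (ENNReal.ofReal ((k + m).choose k / (beta k 1 * beta 1 m)) •
          volume.withDensity (betaKernel k 1 0 t)).prod
        (volume.withDensity (betaKernel 1 m t 1)) := by
  have hk0 : (0 : ℝ) < k := by exact_mod_cast hk
  have hm0 : (0 : ℝ) < m := by exact_mod_cast hm
  have hUm : Measurable fun ω i => U i ω := measurable_pi_lambda _ hU
  have hX : Measurable fun ω => orderStat (k + m) (fun i => U i ω) k :=
    (measurable_orderStat hk (by omega)).comp hUm
  have hY : Measurable fun ω => orderStat (k + m) (fun i => U i ω) (k + 1) :=
    (measurable_orderStat (by omega) (by omega)).comp hUm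
  set K := ENNReal.ofReal ((k + m).choose k / (beta k 1 * beta 1 m)) with hK
  have h1 : ∀ a, (K • volume.withDensity (betaKernel k 1 0 t)) (Set.Iic a)
      = K * (ENNReal.ofReal (beta k 1) * ENNReal.ofReal (min a t) ^ (k : ℝ)) := fun a => by
    rw [Measure.smul_apply, withDensity_apply _ measurableSet_Iic,
      setLIntegral_Iic_betaKernel_one hk0, smul_eq_mul]
  have h2 : ∀ b, volume.withDensity (betaKernel 1 m t 1) (Set.Ioi b)
      = ENNReal.ofReal (beta 1 m) * ENNReal.ofReal (1 - max b t) ^ (m : ℝ) := fun b => by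
    rw [withDensity_apply _ measurableSet_Ioi, setLIntegral_Ioi_betaKernel_one hm0]
  symm
  refine Measure.prod_eq_generateFrom (C := Set.range Set.Iic) (D := Set.range Set.Ioi)
    ((borel_eq_generateFrom_Iic ℝ).symm.trans (BorelSpace.measurable_eq (α := ℝ)).symm)
    ((borel_eq_generateFrom_Ioi ℝ).symm.trans (BorelSpace.measurable_eq (α := ℝ)).symm)
    isPiSystem_Iic isPiSystem_Ioi
    ⟨fun j => Set.Iic (j : ℝ), fun j => ⟨_, rfl⟩, fun j => ?_, ?_⟩
    ⟨fun j => Set.Ioi (-(j : ℝ)), fun j => ⟨_, rfl⟩, fun j => ?_, ?_⟩ ?_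
  · rw [h1, ENNReal.rpow_natCast]
    finiteness
  · exact Set.eq_univ_of_forall fun x => Set.mem_iUnion.mpr (exists_nat_ge x)
  · rw [h2, ENNReal.rpow_natCast]
    finiteness
  · refine Set.eq_univ_of_forall fun x => Set.mem_iUnion.mpr ?_
    obtain ⟨j, hj⟩ := exists_nat_gt (-x)
    exact ⟨j, by simp only [Set.mem_Ioi]; linarith⟩
  · rintro _ ⟨a, rfl⟩ _ ⟨b, rfl⟩
    rw [h1, h2, Measure.restrict_apply (measurableSet_Iic.prod measurableSet_Ioi),
      Set.prod_inter_prod, Set.Iic_inter_Iic, Set.Ioi_inter_Ioi,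
      Measure.map_apply (hX.prodMk hY) (measurableSet_Iic.prod measurableSet_Ioi)]
    have hmain := measure_orderStat_le_and_lt_orderStat_succ hk (by omega) hU hlaw hindep
      ((min_le_right a t).trans (le_max_right b t))
    rw [volume_restrict_Icc_Iic ((min_le_right a t).trans ht1.le),
      volume_restrict_Icc_Ioi (ht0.le.trans (le_max_right b t)), Nat.add_sub_cancel_left] at hmain
    have hKmul : K * ENNReal.ofReal (beta k 1) * ENNReal.ofReal (beta 1 m)
        = ((k + m).choose k : ENNReal) := by
      have hb1 := beta_pos hk0 one_pos
      have hb2 := beta_pos one_pos hm0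
      rw [hK, ← ENNReal.ofReal_mul (by positivity), ← ENNReal.ofReal_mul (by positivity),
        ← ENNReal.ofReal_natCast]
      congr 1
      field_simp
    rw [ENNReal.rpow_natCast, ENNReal.rpow_natCast]
    refine Eq.trans ?_ (hmain.trans ?_)
    · rfl
    · rw [← hKmul]
      ring

/-- The left factor of the arcsine density at `t` on an interval with left endpoint `x`. -/
noncomputable def lowerHalfKernel (t x : ℝ) : ENNReal :=
  if x < t then ENNReal.ofReal ((t - x) ^ (1/2 - 1 : ℝ)) else 0

/-- The right factor of the arcsine density at `t` on an interval with right endpoint `y`. -/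
noncomputable def upperHalfKernel (t y : ℝ) : ENNReal :=
  if t < y then ENNReal.ofReal ((y - t) ^ (1/2 - 1 : ℝ)) else 0

lemma measurable_lowerHalfKernel : Measurable fun p : ℝ × ℝ => lowerHalfKernel p.1 p.2 :=
  Measurable.ite (measurableSet_lt measurable_snd measurable_fst) (by fun_prop) measurable_const

lemma measurable_upperHalfKernel : Measurable fun p : ℝ × ℝ => upperHalfKernel p.1 p.2 :=
  Measurable.ite (measurableSet_lt measurable_fst measurable_snd) (by fun_prop) measurable_const

lemma betaKernel_half_half (x y t : ℝ) :
    betaKernel (1/2) (1/2) x y t = lowerHalfKernel t x * upperHalfKernel t y := by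
  by_cases hx : x < t <;> by_cases hy : t < y <;>
    simp only [betaKernel, lowerHalfKernel, upperHalfKernel, Set.indicator, Set.mem_Ioo, hx, hy,
      and_self, and_true, and_false, if_true, if_false, ENNReal.ofReal_zero, mul_zero, zero_mul]
  rw [ENNReal.ofReal_mul (Real.rpow_nonneg (by linarith) _)]

lemma betaKernel_mul_lowerHalfKernel (a t x : ℝ) :
    betaKernel a 1 0 t x * lowerHalfKernel t x = betaKernel a (1/2) 0 t x := by
  by_cases h0 : 0 < x <;> by_cases hx : x < t <;>
    simp only [betaKernel, lowerHalfKernel, Set.indicator, Set.mem_Ioo, hx, h0, sub_self,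
      Real.rpow_zero, mul_one,
      and_self, and_true, and_false, if_true, if_false, ENNReal.ofReal_zero, mul_zero, zero_mul]
  rw [ENNReal.ofReal_mul (Real.rpow_nonneg (by linarith) _)]

lemma betaKernel_mul_upperHalfKernel (b t y : ℝ) :
    betaKernel 1 b t 1 y * upperHalfKernel t y = betaKernel (1/2) b t 1 y := by
  by_cases h1 : y < 1 <;> by_cases hy : t < y <;>
    simp only [betaKernel, upperHalfKernel, Set.indicator, Set.mem_Ioo, hy, h1, sub_self,
      Real.rpow_zero, one_mul,
      and_self, and_true, and_false, if_true, if_false, ENNReal.ofReal_zero, mul_zero, zero_mul]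
  rw [ENNReal.ofReal_mul (Real.rpow_nonneg (by linarith) _), mul_comm]

lemma choose_mul_beta_eq {k m : ℕ} (hk : 1 ≤ k) (hm : 1 ≤ m) :
    (beta (1/2) (1/2))⁻¹ * (((k + m).choose k / (beta k 1 * beta 1 m)) * beta k (1/2)
      * beta (1/2) m) = (beta (k + 1/2) (m + 1/2))⁻¹ := by
  have hk0 : (0 : ℝ) < k := by exact_mod_cast hk
  have hm0 : (0 : ℝ) < m := by exact_mod_cast hm
  have hchoose : ((k + m).choose k : ℝ) * Real.Gamma (k + 1) * Real.Gamma (m + 1)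
      = Real.Gamma (k + m + 1) := by
    rw [Real.Gamma_nat_eq_factorial, Real.Gamma_nat_eq_factorial, ← Nat.cast_add,
      Real.Gamma_nat_eq_factorial]
    have h := Nat.choose_mul_factorial_mul_factorial (Nat.le_add_right k m)
    rw [Nat.add_sub_cancel_left] at h
    exact_mod_cast h
  have g1 := (Real.Gamma_pos_of_pos hk0).ne'
  have g2 := (Real.Gamma_pos_of_pos hm0).ne'
  have g3 := (Real.Gamma_pos_of_pos (show (0 : ℝ) < k + 1 by positivity)).ne'
  have g4 := (Real.Gamma_pos_of_pos (show (0 : ℝ) < m + 1 by positivity)).ne'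
  have g5 := (Real.Gamma_pos_of_pos (show (0 : ℝ) < k + 1/2 by positivity)).ne'
  have g6 := (Real.Gamma_pos_of_pos (show (0 : ℝ) < m + 1/2 by positivity)).ne'
  have g7 := (Real.Gamma_pos_of_pos (show (0 : ℝ) < 1/2 by positivity)).ne'
  have g8 := (Real.Gamma_pos_of_pos (show (0 : ℝ) < k + m + 1 by positivity)).ne'
  simp only [beta, Real.Gamma_one, add_comm (1 : ℝ) m, add_comm (1/2 : ℝ) m,
    show (1/2 + 1/2 : ℝ) = 1 by norm_num,
    show (k + 1/2 + (m + 1/2) : ℝ) = k + m + 1 by ring, ← hchoose]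
  rw [← hchoose] at g8
  generalize Real.Gamma (k : ℝ) = a at *
  generalize Real.Gamma (m : ℝ) = b at *
  generalize Real.Gamma (k + 1 : ℝ) = c at *
  generalize Real.Gamma (m + 1 : ℝ) = d at *
  generalize Real.Gamma (k + 1/2 : ℝ) = e at *
  generalize Real.Gamma (m + 1/2 : ℝ) = f at *
  generalize Real.Gamma (1/2 : ℝ) = g at *
  field_simp

lemma betaDensity_le_lintegral_betaKernel
    {Ω : Type*} [MeasurableSpace Ω] {μ : Measure Ω} {k m : ℕ} (hk : 1 ≤ k) (hm : 1 ≤ m)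
    {U : Fin (k + m) → Ω → ℝ} (hU : ∀ i, Measurable (U i))
    (hlaw : ∀ i, Measure.map (U i) μ = volume.restrict (Set.Icc (0 : ℝ) 1))
    (hindep : iIndepFun U μ) (t : ℝ) :
    betaDensity (k + 1/2) (m + 1/2) t ≤
      ∫⁻ p, ENNReal.ofReal (beta (1/2) (1/2))⁻¹ * betaKernel (1/2) (1/2) p.1 p.2 t
        ∂(μ.map fun ω => (orderStat (k + m) (fun i => U i ω) k,
          orderStat (k + m) (fun i => U i ω) (k + 1))) := by
  have hk0 : (0 : ℝ) < k := by exact_mod_cast hk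
  have hm0 : (0 : ℝ) < m := by exact_mod_cast hm
  by_cases ht : t ∈ Set.Ioo (0 : ℝ) 1
  swap
  · simp [betaDensity, Set.indicator_of_notMem ht]
  have ht1 : 0 < 1 - t := sub_pos.mpr ht.2
  refine le_trans (le_of_eq ?_) (setLIntegral_le_lintegral (Set.Iic t ×ˢ Set.Ioi t) _)
  rw [map_orderStat_restrict hk hm hU hlaw hindep ht.1 ht.2]
  have hlow : Measurable (lowerHalfKernel t) := measurable_lowerHalfKernel.of_uncurry_left
  have hup : Measurable (upperHalfKernel t) := measurable_upperHalfKernel.of_uncurry_left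
  simp only [betaKernel_half_half]
  rw [lintegral_const_mul _ (by fun_prop),
    lintegral_prod_mul hlow.aemeasurable hup.aemeasurable, lintegral_smul_measure,
    lintegral_withDensity_eq_lintegral_mul _ (by fun_prop) hlow,
    lintegral_withDensity_eq_lintegral_mul _ (by fun_prop) hup]
  simp only [Pi.mul_apply, betaKernel_mul_lowerHalfKernel, betaKernel_mul_upperHalfKernel]
  have b1 := beta_pos (show (0 : ℝ) < 1/2 by norm_num) (show (0 : ℝ) < 1/2 by norm_num)
  have b2 := beta_pos hk0 one_pos
  have b3 := beta_pos one_pos hm0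
  have b4 := beta_pos hk0 (show (0 : ℝ) < 1/2 by norm_num)
  have b5 := beta_pos (show (0 : ℝ) < 1/2 by norm_num) hm0
  have hrt : (0 : ℝ) ≤ t ^ ((k : ℝ) + 1/2 - 1) := Real.rpow_nonneg ht.1.le _
  rw [lintegral_betaKernel hk0 (by norm_num) ht.1, lintegral_betaKernel (by norm_num) hm0 ht.2,
    smul_eq_mul, sub_zero, ← ENNReal.ofReal_mul (by positivity),
    ← ENNReal.ofReal_mul (by positivity), ← ENNReal.ofReal_mul (by positivity),
    betaDensity_eq_betaKernel (by positivity) (by positivity), betaKernel,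
    Set.indicator_of_mem ht, ← choose_mul_beta_eq hk hm, ← ENNReal.ofReal_mul (by positivity),
    sub_zero, add_comm (1/2 : ℝ) m]
  congr 1
  ring

/-- The FIMA fiducial quantity `θ̂ = U_{[k]} + D (U_{[k+1]} - U_{[k]})`, built from the
order statistics of `n` i.i.d. Uniform(0,1) variables and an independent
`D ~ Beta(1/2,1/2)` interpolation variable, has the Beta(`k+1/2`, `n-k+1/2`)
distribution — the Jeffreys-prior posterior for a binomial proportion with `k`
successes in `n` trials. -/
theorem fima_solution_jeffreys_beta
    {Ω : Type*} [MeasurableSpace Ω] (μ : Measure Ω) [IsProbabilityMeasure μ]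
    (n k : ℕ) (hn : 2 ≤ n) (hk1 : 1 ≤ k) (hkn : k ≤ n - 1)
    (U : Fin n → Ω → ℝ) (hUmeas : ∀ i, Measurable (U i))
    (hUunif : ∀ i, Measure.map (U i) μ = volume.restrict (Set.Icc (0 : ℝ) 1))
    (hUindep : iIndepFun (m := fun _ : Fin n => (inferInstance : MeasurableSpace ℝ)) U μ)
    (D : Ω → ℝ) (hDmeas : Measurable D)
    (hDdist : Measure.map D μ = volume.withDensity (betaDensity (1/2) (1/2)))
    (hDindep : IndepFun (fun ω => fun i : Fin n => U i ω) D μ) :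
    Measure.map
        (fun ω => orderStat n (fun i => U i ω) k
          + D ω * (orderStat n (fun i => U i ω) (k + 1)
                    - orderStat n (fun i => U i ω) k)) μ
      = volume.withDensity (betaDensity ((k : ℝ) + 1/2) ((n : ℝ) - (k : ℝ) + 1/2)) := by
  obtain ⟨m, rfl⟩ : ∃ m, n = k + m := ⟨n - k, by omega⟩
  have hm : 1 ≤ m := by omega
  have hUm : Measurable fun ω i => U i ω := measurable_pi_lambda _ hUmeas
  have hXY : Measurable fun f : Fin (k + m) → ℝ =>
      (orderStat (k + m) f k, orderStat (k + m) f (k + 1)) :=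
    (measurable_orderStat hk1 (by omega)).prodMk (measurable_orderStat (by omega) (by omega))
  set V : Ω → ℝ × ℝ := fun ω => (orderStat (k + m) (fun i => U i ω) k,
    orderStat (k + m) (fun i => U i ω) (k + 1)) with hV
  have hVm : Measurable V := hXY.comp hUm
  have hVD : IndepFun V D μ := hDindep.comp hXY measurable_id
  have hjoint := (indepFun_iff_map_prod_eq_prod_map_map hVm.aemeasurable hDmeas.aemeasurable).mp hVD
  have hΦ : Measurable fun q : (ℝ × ℝ) × ℝ => q.1.1 + q.2 * (q.1.2 - q.1.1) := by fun_prop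
  rw [show ((k + m : ℕ) : ℝ) - k + 1/2 = m + 1/2 by push_cast; ring]
  have hprob : IsProbabilityMeasure (Measure.map D μ) :=
    Measure.isProbabilityMeasure_map hDmeas.aemeasurable
  have hprobV : IsProbabilityMeasure (Measure.map V μ) :=
    Measure.isProbabilityMeasure_map hVm.aemeasurable
  have htotal : volume.withDensity (betaDensity (k + 1/2) (m + 1/2)) Set.univ = 1 := by
    rw [withDensity_apply _ MeasurableSet.univ, Measure.restrict_univ,
      lintegral_betaDensity (by positivity) (by positivity)]
  have : IsFiniteMeasure (volume.withDensity (betaDensity (k + 1/2) (m + 1/2))) :=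
    ⟨by rw [htotal]; exact ENNReal.one_lt_top⟩
  have hcomp : Measurable fun ω => orderStat (k + m) (fun i => U i ω) k
          + D ω * (orderStat (k + m) (fun i => U i ω) (k + 1)
                    - orderStat (k + m) (fun i => U i ω) k) := hΦ.comp (hVm.prodMk hDmeas)
  symm
  refine Measure.eq_of_le_of_measure_univ_eq (Measure.le_iff.mpr fun A hA => ?_) ?_
  swap
  · rw [htotal, Measure.map_apply hcomp MeasurableSet.univ, Set.preimage_univ, measure_univ]
  have hkernel : Measurable fun q : (ℝ × ℝ) × ℝ =>
      ENNReal.ofReal (beta (1/2) (1/2))⁻¹ * betaKernel (1/2) (1/2) q.1.1 q.1.2 q.2 := by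
    simp only [betaKernel_half_half]
    have h1 := measurable_lowerHalfKernel.comp
      (show Measurable fun q : (ℝ × ℝ) × ℝ => (q.2, q.1.1) by fun_prop)
    have h2 := measurable_upperHalfKernel.comp
      (show Measurable fun q : (ℝ × ℝ) × ℝ => (q.2, q.1.2) by fun_prop)
    exact (h1.mul h2).const_mul _
  calc volume.withDensity (betaDensity (k + 1/2) (m + 1/2)) A
      = ∫⁻ t in A, betaDensity (k + 1/2) (m + 1/2) t := withDensity_apply _ hA
    _ ≤ ∫⁻ t in A, (∫⁻ p, ENNReal.ofReal (beta (1/2) (1/2))⁻¹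
          * betaKernel (1/2) (1/2) p.1 p.2 t ∂(μ.map V)) :=
        lintegral_mono fun t =>
          betaDensity_le_lintegral_betaKernel hk1 hm hUmeas hUunif hUindep t
    _ = ∫⁻ p, (∫⁻ t in A, ENNReal.ofReal (beta (1/2) (1/2))⁻¹
          * betaKernel (1/2) (1/2) p.1 p.2 t) ∂(μ.map V) :=
        (lintegral_lintegral_swap hkernel.aemeasurable).symm
    _ ≤ ∫⁻ p, Measure.map D μ {d | p.1 + d * (p.2 - p.1) ∈ A} ∂(μ.map V) := by
        refine lintegral_mono fun p => ?_
        rcases lt_or_ge p.1 p.2 with hp | hp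
        · rw [hDdist, withDensity_betaDensity_half_preimage hp hA]
        · simp [betaKernel, Set.Ioo_eq_empty hp.not_gt]
    _ = ((μ.map V).prod (μ.map D)) ((fun q => q.1.1 + q.2 * (q.1.2 - q.1.1)) ⁻¹' A) := by
        rw [Measure.prod_apply (hΦ hA)]
        rfl
    _ = μ.map (fun ω => (V ω).1 + D ω * ((V ω).2 - (V ω).1)) A := by
        rw [← hjoint, ← Measure.map_apply hΦ hA, Measure.map_map hΦ (hVm.prodMk hDmeas)]
        rfl
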